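/- arXiv:math-ph/0601063 — 3 statements merged into one kernel-verified Lean document; each statement's English description precedes it below -/
import Mathlib

section
/- Let 1 ≤ p ≤ ∞ and let T : M_n(ℂ) → M_r(ℂ) be a linear map that is positive (maps positive semi-definite matrices to positive semi-definite matrices) and trace preserving (tr T(A) = tr A for all A). Then for every A ∈ M_n(ℂ), ‖T(A)‖_p ≤ n^{1-1/p} ‖A‖_p; that is, the operator norm of T from S_p^n to S_p^r satisfies ‖T‖_{p-p} ≤ n^{1-1/p}. -/
open scoped ENNReal ComplexOrder

/-- The singular values of a complex square matrix `A`, i.e. the (square roots of the)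
eigenvalues of `Aᴴ * A`. -/
noncomputable def singularValues {n : ℕ} (A : Matrix (Fin n) (Fin n) ℂ) : Fin n → ℝ :=
  fun i => Real.sqrt ((Matrix.posSemidef_conjTranspose_mul_self A).isHermitian.eigenvalues i)

/-- The Schatten `p`-norm `‖A‖_p = (tr |A|^p)^{1/p}`; for `p = ∞` it is the operator
(largest singular value) norm. -/
noncomputable def schattenNorm {n : ℕ} (p : ℝ≥0∞) (A : Matrix (Fin n) (Fin n) ℂ) : ℝ :=
  if p = ⊤ then ⨆ i, singularValues A i
  else (∑ i, singularValues A i ^ p.toReal) ^ (1 / p.toReal)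

/-- A linear map between matrix algebras is positive if it maps positive semi-definite
matrices to positive semi-definite matrices. -/
def IsPositiveMatrixMap {n r : ℕ} (T : Matrix (Fin n) (Fin n) ℂ →ₗ[ℂ] Matrix (Fin r) (Fin r) ℂ) :
    Prop :=
  ∀ A : Matrix (Fin n) (Fin n) ℂ, A.PosSemidef → (T A).PosSemidef

/-- A linear map between matrix algebras is trace preserving if `tr T(A) = tr A` for all `A`. -/
def IsTracePreservingMap {n r : ℕ}
    (T : Matrix (Fin n) (Fin n) ℂ →ₗ[ℂ] Matrix (Fin r) (Fin r) ℂ) : Prop :=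
  ∀ A : Matrix (Fin n) (Fin n) ℂ, (T A).trace = A.trace

open Matrix

theorem aux_svd {n : ℕ} (A : Matrix (Fin n) (Fin n) ℂ) :
    ∃ U V : Matrix (Fin n) (Fin n) ℂ, Uᴴ * U = 1 ∧ Vᴴ * V = 1 ∧
      A = U * diagonal (fun i => (singularValues A i : ℂ)) * Vᴴ := by
  have hH := (Matrix.posSemidef_conjTranspose_mul_self A).isHermitian
  have hnn := (Matrix.posSemidef_conjTranspose_mul_self A).eigenvalues_nonneg
  let l : Fin n → ℝ := hH.eigenvalues
  have hsv : ∀ i, singularValues A i = Real.sqrt (l i) := fun i => rfl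
  let V : Matrix (Fin n) (Fin n) ℂ := hH.eigenvectorUnitary
  have hV1 : Vᴴ * V = 1 := Unitary.coe_star_mul_self hH.eigenvectorUnitary
  have hV2 : V * Vᴴ = 1 := Unitary.coe_mul_star_self hH.eigenvectorUnitary
  have hsp : Aᴴ * A = V * diagonal (fun i => (l i : ℂ)) * Vᴴ := by
    have := hH.spectral_theorem
    rw [Unitary.conjStarAlgAut_apply] at this
    exact this
  have hG : (A * V)ᴴ * (A * V) = diagonal (fun i => (l i : ℂ)) := by
    rw [conjTranspose_mul]
    calc Vᴴ * Aᴴ * (A * V) = Vᴴ * (Aᴴ * A) * V := by simp only [Matrix.mul_assoc]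
      _ = (Vᴴ * V) * diagonal (fun i => (l i : ℂ)) * (Vᴴ * V) := by
        rw [hsp]; simp only [Matrix.mul_assoc]
      _ = _ := by rw [hV1]; simp
  let x : Fin n → EuclideanSpace ℂ (Fin n) := fun i => WithLp.toLp 2 (fun k => (A * V) k i)
  have hx : ∀ i j, inner ℂ (x i) (x j) = if i = j then (l i : ℂ) else 0 := by
    intro i j
    have := congrFun (congrFun hG i) j
    rw [diagonal_apply] at this
    rw [← this, PiLp.inner_apply, mul_apply]
    refine Finset.sum_congr rfl fun k _ => ?_
    simp [x, conjTranspose_apply, mul_comm]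
  let f : Fin n → EuclideanSpace ℂ (Fin n) := fun i => ((Real.sqrt (l i) : ℂ)⁻¹) • x i
  have hf : Orthonormal ℂ (Set.domRestrict {i | l i ≠ 0} f) := by
    rw [orthonormal_iff_ite]
    rintro ⟨i, hi⟩ ⟨j, hj⟩
    change inner ℂ (f i) (f j) = _
    simp only [f, inner_smul_left, inner_smul_right, hx, Subtype.mk.injEq]
    by_cases h : i = j
    · subst h
      have hi' : 0 < l i := lt_of_le_of_ne (hnn i) (Ne.symm hi)
      have h2 : (Real.sqrt (l i) : ℂ) * (Real.sqrt (l i) : ℂ) = (l i : ℂ) := by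
        rw [← Complex.ofReal_mul, Real.mul_self_sqrt hi'.le]
      have h3 : (Real.sqrt (l i) : ℂ) ≠ 0 := by
        exact_mod_cast (Real.sqrt_pos.2 hi').ne'
      simp only [if_true, map_inv₀, Complex.conj_ofReal]
      rw [← h2]; field_simp
    · simp [h]
  obtain ⟨b, hb⟩ := hf.exists_orthonormalBasis_extension_of_card_eq (by simp)
  have hxb : ∀ i, x i = (Real.sqrt (l i) : ℂ) • b i := by
    intro i
    by_cases h : l i = 0
    · have : inner ℂ (x i) (x i) = 0 := by rw [hx]; simp [h]
      rw [inner_self_eq_zero.1 this]; simp [h]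
    · rw [hb i h]
      have h3 : (Real.sqrt (l i) : ℂ) ≠ 0 := by
        exact_mod_cast (Real.sqrt_pos.2 (lt_of_le_of_ne (hnn i) (Ne.symm h))).ne'
      simp only [f]
      rw [smul_inv_smul₀ h3]
  let U : Matrix (Fin n) (Fin n) ℂ := Matrix.of fun k i => b i k
  refine ⟨U, V, ?_, hV1, ?_⟩
  · ext i j
    have := orthonormal_iff_ite.1 b.orthonormal i j
    rw [one_apply, ← this, PiLp.inner_apply, mul_apply]
    refine Finset.sum_congr rfl fun k _ => ?_
    simp [U, conjTranspose_apply, mul_comm]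
  · have : A * V = U * diagonal (fun i => (singularValues A i : ℂ)) := by
      ext k i
      rw [mul_diagonal, hsv]
      have := congrArg (fun y : EuclideanSpace ℂ (Fin n) => y k) (hxb i)
      simp only [x, PiLp.smul_apply, smul_eq_mul] at this
      rw [this, mul_comm]; rfl
    rw [← this, Matrix.mul_assoc, hV2, Matrix.mul_one]

open scoped Matrix.Norms.L2Operator in
theorem aux_unitary {n : ℕ} (W : Matrix (Fin n) (Fin n) ℂ) (hW : W ∈ unitary (Matrix (Fin n) (Fin n) ℂ)) :
    ∃ (ι : Type) (_ : Fintype ι) (c : ι → ℂ) (Q : ι → Matrix (Fin n) (Fin n) ℂ),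
      (∀ i, ‖c i‖ = 1) ∧ (∀ i, (Q i).PosSemidef) ∧ ∑ i, Q i = 1 ∧ W = ∑ i, c i • Q i := by
  classical
  have hN : IsStarNormal W := ⟨by
    rw [Commute, SemiconjBy, (Unitary.mem_iff.1 hW).1, (Unitary.mem_iff.1 hW).2]⟩
  have hfin : (spectrum ℂ W).Finite := W.finite_spectrum
  have := hfin.fintype
  have hc : ∀ f : ℂ → ℂ, ContinuousOn f (spectrum ℂ W) := fun f => hfin.continuousOn f
  let g : ℂ → ℂ → ℂ := fun l z => if z = l then 1 else 0
  refine ⟨spectrum ℂ W, inferInstance, fun i => i, fun i => cfc (g i) W, ?_, ?_, ?_, ?_⟩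
  · intro i
    have := spectrum.subset_circle_of_unitary hW i.2
    simpa using this
  · intro i
    have : cfc (g i) W = (cfc (g i) W)ᴴ * cfc (g i) W := by
      rw [← star_eq_conjTranspose, ← cfc_star, ← cfc_mul _ _ W (hc _) (hc _)]
      congr 1
      ext z
      simp only [g]
      split_ifs <;> simp
    change (cfc (g i) W).PosSemidef
    rw [this]
    exact posSemidef_conjTranspose_mul_self _
  · rw [← cfc_sum_univ (fun i : spectrum ℂ W => g i) W (fun i => hc _), ← cfc_one ℂ W]
    refine cfc_congr fun z hz => ?_
    simp only [Finset.sum_apply, g]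
    rw [Finset.sum_eq_single (⟨z, hz⟩ : spectrum ℂ W)]
    · simp
    · rintro ⟨y, hy⟩ _ h
      rw [if_neg]
      rintro rfl; exact h rfl
    · simp
  · conv_lhs => rw [← cfc_id ℂ W]
    have : ∀ i : spectrum ℂ W, (i : ℂ) • cfc (g i) W = cfc (fun z => (i : ℂ) • g i z) W :=
      fun i => (cfc_smul _ _ W (hc _)).symm
    simp only [this]
    rw [← cfc_sum_univ (fun i : spectrum ℂ W => fun z => (i : ℂ) • g i z) W (fun i => hc _)]
    refine cfc_congr fun z hz => ?_
    simp only [Finset.sum_apply, g]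
    rw [Finset.sum_eq_single (⟨z, hz⟩ : spectrum ℂ W)]
    · simp
    · rintro ⟨y, hy⟩ _ h
      rw [if_neg]
      · simp
      rintro rfl; exact h rfl
    · simp

theorem aux_cs {n : ℕ} (φ : Matrix (Fin n) (Fin n) ℂ →ₗ[ℂ] ℂ)
    (hφ : ∀ P : Matrix (Fin n) (Fin n) ℂ, P.PosSemidef → 0 ≤ φ P) (u v : Fin n → ℂ) :
    ‖φ (vecMulVec u (star v))‖ ≤
      ((φ (vecMulVec u (star u))).re + (φ (vecMulVec v (star v))).re) / 2 := by
  set a := φ (vecMulVec u (star v)) with ha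
  set b := φ (vecMulVec v (star u)) with hb
  set x := φ (vecMulVec u (star u))
  set y := φ (vecMulVec v (star v))
  have key : ∀ c : ℂ, 0 ≤ x + star c * a + c * b + c * star c * y := by
    intro c
    have := hφ _ (posSemidef_vecMulVec_self_star (u + c • v))
    have e : vecMulVec (u + c • v) (star (u + c • v)) = vecMulVec u (star u)
        + star c • vecMulVec u (star v) + c • vecMulVec v (star u)
        + (c * star c) • vecMulVec v (star v) := by
      ext i j
      simp [vecMulVec_apply]
      ring
    rw [e] at this
    simpa only [map_add, map_smul, smul_eq_mul] using this
  have k1 := Complex.le_def.1 (key 1)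
  have k0 := Complex.le_def.1 (key (-1))
  have k2 := Complex.le_def.1 (key Complex.I)
  have hx := Complex.le_def.1 (hφ _ (posSemidef_vecMulVec_self_star u))
  simp at k1 k0 k2
  have hyx : x.im = 0 ∧ y.im = 0 :=
    ⟨(Complex.le_def.1 (hφ _ (posSemidef_vecMulVec_self_star u))).2.symm,
     (Complex.le_def.1 (hφ _ (posSemidef_vecMulVec_self_star v))).2.symm⟩
  have hbre : b.re = a.re := by linarith [k2.2, hyx.1, hyx.2]
  have hbim : b.im = -a.im := by linarith [k1.2, hyx.1, hyx.2]
  have hba : b = star a := by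
    apply Complex.ext <;> simp [hbre, hbim]
  by_cases h0 : a = 0
  · rw [h0, norm_zero]
    have e1 : 0 ≤ x.re := (Complex.le_def.1 (hφ _ (posSemidef_vecMulVec_self_star u))).1
    have e2 : 0 ≤ y.re := (Complex.le_def.1 (hφ _ (posSemidef_vecMulVec_self_star v))).1
    linarith
  have hn : (‖a‖ : ℂ) ≠ 0 := by exact_mod_cast norm_ne_zero_iff.2 h0
  have haa : a * star a = (‖a‖ : ℂ) ^ 2 := Complex.mul_conj' a
  have k := key (-(a / ‖a‖))
  have e : x + star (-(a / ‖a‖)) * a + (-(a / ‖a‖)) * b + (-(a / ‖a‖)) * star (-(a / ‖a‖)) * y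
      = x + y - 2 * (‖a‖ : ℂ) := by
    rw [hba]
    have : star (-(a / (‖a‖ : ℂ))) = - (star a / (‖a‖ : ℂ)) := by simp
    rw [this]
    field_simp
    linear_combination (y - 2 * ‖a‖) * haa
  rw [e] at k
  have := (Complex.le_def.1 k).1
  simp at this
  linarith

open scoped MatrixOrder in
theorem aux_trace_mul_nonneg {n : ℕ} (P Q : Matrix (Fin n) (Fin n) ℂ) (hP : P.PosSemidef)
    (hQ : Q.PosSemidef) : 0 ≤ (Q * P).trace := by
  obtain ⟨B, rfl⟩ := CStarAlgebra.nonneg_iff_eq_star_mul_self.mp hQ.nonneg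
  rw [star_eq_conjTranspose, Matrix.mul_assoc, Matrix.trace_mul_comm]
  exact (hP.mul_mul_conjTranspose_same B).trace_nonneg

theorem aux_rank_one {n r : ℕ}
    (T : Matrix (Fin n) (Fin n) ℂ →ₗ[ℂ] Matrix (Fin r) (Fin r) ℂ)
    (hTpos : IsPositiveMatrixMap T) (hTtr : IsTracePreservingMap T)
    (W : Matrix (Fin r) (Fin r) ℂ) (hW : W ∈ unitary (Matrix (Fin r) (Fin r) ℂ))
    (u v : Fin n → ℂ) (hu : u ⬝ᵥ star u = 1) (hv : v ⬝ᵥ star v = 1) :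
    ‖(W * T (vecMulVec u (star v))).trace‖ ≤ 1 := by
  obtain ⟨ι, _, c, Q, hc, hQ, hs, hWe⟩ := aux_unitary W hW
  let φ : ι → Matrix (Fin n) (Fin n) ℂ →ₗ[ℂ] ℂ := fun i =>
    (traceLinearMap (Fin r) ℂ ℂ) ∘ₗ (LinearMap.mulLeft ℂ (Q i)) ∘ₗ T
  have hφ : ∀ i X, φ i X = (Q i * T X).trace := fun i X => rfl
  have hsum : ∀ X, ∑ i, φ i X = X.trace := by
    intro X
    simp only [hφ]
    rw [← trace_sum, ← Finset.sum_mul, hs, Matrix.one_mul, hTtr]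
  have e : (W * T (vecMulVec u (star v))).trace = ∑ i, c i * φ i (vecMulVec u (star v)) := by
    rw [hWe, Finset.sum_mul, trace_sum]
    simp [hφ]
  rw [e]
  calc _ ≤ ∑ i, ‖c i * φ i (vecMulVec u (star v))‖ := norm_sum_le _ _
    _ = ∑ i, ‖φ i (vecMulVec u (star v))‖ := by simp [hc]
    _ ≤ ∑ i, ((φ i (vecMulVec u (star u))).re + (φ i (vecMulVec v (star v))).re) / 2 :=
      Finset.sum_le_sum fun i _ => aux_cs _
        (fun P hP => aux_trace_mul_nonneg _ _ (hTpos P hP) (hQ i)) u v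
    _ = 1 := by
      rw [← Finset.sum_div, Finset.sum_add_distrib, ← Complex.re_sum, ← Complex.re_sum,
        hsum, hsum, trace_vecMulVec, trace_vecMulVec, hu, hv]
      norm_num

theorem aux_trace_norm {n r : ℕ}
    (T : Matrix (Fin n) (Fin n) ℂ →ₗ[ℂ] Matrix (Fin r) (Fin r) ℂ)
    (hTpos : IsPositiveMatrixMap T) (hTtr : IsTracePreservingMap T)
    (A : Matrix (Fin n) (Fin n) ℂ) :
    ∑ i, singularValues (T A) i ≤ ∑ i, singularValues A i := by
  obtain ⟨U, V, hU, hV, hA⟩ := aux_svd A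
  obtain ⟨X, Y, hX, hY, hB⟩ := aux_svd (T A)
  have hX' := mul_eq_one_comm.1 hX
  have hY' := mul_eq_one_comm.1 hY
  have hW : Y * Xᴴ ∈ unitary (Matrix (Fin r) (Fin r) ℂ) := by
    rw [Unitary.mem_iff, star_eq_conjTranspose, conjTranspose_mul, conjTranspose_conjTranspose]
    constructor
    · rw [Matrix.mul_assoc, ← Matrix.mul_assoc Yᴴ, hY, Matrix.one_mul, hX']
    · rw [Matrix.mul_assoc, ← Matrix.mul_assoc Xᴴ, hX, Matrix.one_mul, hY']
  have h1 : ((∑ i, singularValues (T A) i : ℝ) : ℂ) = (Y * Xᴴ * T A).trace := by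
    conv_rhs => rw [hB]
    rw [trace_mul_comm, Matrix.mul_assoc, ← Matrix.mul_assoc Yᴴ, hY, Matrix.one_mul,
      trace_mul_comm, ← Matrix.mul_assoc, hX, Matrix.one_mul, trace_diagonal]
    simp
  have hdec : A = ∑ i, (singularValues A i : ℂ) • vecMulVec (fun k => U k i) (star fun k => V k i) := by
    conv_lhs => rw [hA]
    ext k l
    rw [mul_apply, Matrix.sum_apply]
    refine Finset.sum_congr rfl fun i _ => ?_
    simp [mul_diagonal, vecMulVec_apply]
    ring
  have hunit : ∀ (M : Matrix (Fin n) (Fin n) ℂ), Mᴴ * M = 1 → ∀ i,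
      (fun k => M k i) ⬝ᵥ star (fun k => M k i) = 1 := by
    intro M hM i
    have := congrFun (congrFun hM i) i
    rw [mul_apply, one_apply_eq] at this
    rw [← this, dotProduct]
    refine Finset.sum_congr rfl fun k _ => ?_
    simp [mul_comm]
  have hnn : ∀ i, 0 ≤ singularValues A i := fun i => Real.sqrt_nonneg _
  have h2 : (Y * Xᴴ * T A).trace = ∑ i, (singularValues A i : ℂ) *
      (Y * Xᴴ * T (vecMulVec (fun k => U k i) (star fun k => V k i))).trace := by
    conv_lhs => rw [hdec]
    rw [map_sum, Finset.mul_sum, trace_sum]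
    simp
  calc ∑ i, singularValues (T A) i ≤ ‖((∑ i, singularValues (T A) i : ℝ) : ℂ)‖ := by
        rw [Complex.norm_real]; exact le_abs_self _
    _ ≤ ∑ i, ‖(singularValues A i : ℂ) *
      (Y * Xᴴ * T (vecMulVec (fun k => U k i) (star fun k => V k i))).trace‖ := by
        rw [h1, h2]; exact norm_sum_le _ _
    _ ≤ ∑ i, singularValues A i := by
        refine Finset.sum_le_sum fun i _ => ?_
        rw [norm_mul, Complex.norm_real, Real.norm_of_nonneg (hnn i)]
        exact mul_le_of_le_one_right (hnn i)
          (aux_rank_one T hTpos hTtr _ hW _ _ (hunit U hU i) (hunit V hV i))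

theorem aux_sum_rpow {r : ℕ} (s : Fin r → ℝ) (hs : ∀ i, 0 ≤ s i) (q : ℝ) (hq : 1 ≤ q) :
    (∑ i, s i ^ q) ≤ (∑ i, s i) ^ q := by
  set S := ∑ i, s i with hS
  have hS0 : 0 ≤ S := Finset.sum_nonneg fun i _ => hs i
  calc ∑ i, s i ^ q ≤ ∑ i, s i * S ^ (q - 1) := by
        refine Finset.sum_le_sum fun i _ => ?_
        have hi : s i ≤ S := Finset.single_le_sum (fun j _ => hs j) (Finset.mem_univ i)
        have : s i ^ q = s i * s i ^ (q - 1) := by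
          have := Real.rpow_add' (hs i) (y := 1) (z := q - 1) (by linarith)
          rw [Real.rpow_one] at this
          rw [← this]; congr 1; ring
        rw [this]
        exact mul_le_mul_of_nonneg_left (Real.rpow_le_rpow (hs i) hi (by linarith)) (hs i)
    _ = S ^ q := by
        rw [← Finset.sum_mul, ← hS]
        have := Real.rpow_add' hS0 (y := 1) (z := q - 1) (by linarith)
        rw [Real.rpow_one] at this
        rw [← this]; congr 1; ring

/-- **Theorem 1.** If `T : M_n(ℂ) → M_r(ℂ)` is positive and trace preserving and `1 ≤ p ≤ ∞`,
then `‖T(A)‖_p ≤ n^{1-1/p} ‖A‖_p` for every `A` (reading `1/p = 0` for `p = ∞`). -/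
theorem schattenNorm_apply_le_of_posMap_tracePreserving
    (n r : ℕ) (p : ℝ≥0∞) (hp : 1 ≤ p)
    (T : Matrix (Fin n) (Fin n) ℂ →ₗ[ℂ] Matrix (Fin r) (Fin r) ℂ)
    (hTpos : IsPositiveMatrixMap T) (hTtr : IsTracePreservingMap T)
    (A : Matrix (Fin n) (Fin n) ℂ) :
    schattenNorm p (T A) ≤ (n : ℝ) ^ ((1 : ℝ) - 1 / p.toReal) * schattenNorm p A := by
  have hmain := aux_trace_norm T hTpos hTtr A
  have hA : ∀ i, 0 ≤ singularValues A i := fun i => Real.sqrt_nonneg _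
  have hB : ∀ i, 0 ≤ singularValues (T A) i := fun i => Real.sqrt_nonneg _
  unfold schattenNorm
  by_cases htop : p = ⊤
  · simp only [htop, if_true, ENNReal.toReal_top, div_zero, sub_zero, Real.rpow_one]
    have hright : ∑ i, singularValues A i ≤ n * ⨆ i, singularValues A i := by
      calc _ ≤ ∑ i : Fin n, ⨆ i, singularValues A i :=
            Finset.sum_le_sum fun i _ => le_ciSup (Set.finite_range _).bddAbove i
        _ = _ := by simp
    refine le_trans ?_ (hmain.trans hright)
    refine Real.iSup_le (fun i => ?_) (Finset.sum_nonneg fun i _ => hB i)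
    exact Finset.single_le_sum (fun j _ => hB j) (Finset.mem_univ i)
  · simp only [htop, if_false]
    set q := p.toReal with hq
    have hq1 : 1 ≤ q := by
      have := ENNReal.toReal_mono htop hp
      simpa using this
    have hq0 : 0 < q := by linarith
    have hSA : 0 ≤ ∑ i, singularValues A i := Finset.sum_nonneg fun i _ => hA i
    have hSB : 0 ≤ ∑ i, singularValues (T A) i := Finset.sum_nonneg fun i _ => hB i
    have h1 : (∑ i, singularValues (T A) i ^ q) ^ (1 / q) ≤ ∑ i, singularValues (T A) i := by
      calc _ ≤ ((∑ i, singularValues (T A) i) ^ q) ^ (1 / q) :=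
            Real.rpow_le_rpow (Finset.sum_nonneg fun i _ => Real.rpow_nonneg (hB i) _)
              (aux_sum_rpow _ hB q hq1) (by positivity)
        _ = _ := by rw [one_div, Real.rpow_rpow_inv hSB hq0.ne']
    refine h1.trans (hmain.trans ?_)
    have h2 := Real.rpow_sum_le_const_mul_sum_rpow_of_nonneg Finset.univ hq1 (fun i _ => hA i)
    have hP : 0 ≤ ∑ i, singularValues A i ^ q :=
      Finset.sum_nonneg fun i _ => Real.rpow_nonneg (hA i) _
    calc ∑ i, singularValues A i = ((∑ i, singularValues A i) ^ q) ^ (1 / q) := by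
          rw [one_div, Real.rpow_rpow_inv hSA hq0.ne']
      _ ≤ ((n : ℝ) ^ (q - 1) * ∑ i, singularValues A i ^ q) ^ (1 / q) := by
          refine Real.rpow_le_rpow (Real.rpow_nonneg hSA _) ?_ (by positivity)
          simpa using h2
      _ = _ := by
          rw [Real.mul_rpow (by positivity) hP, ← Real.rpow_mul (by positivity)]
          congr 2
          field_simp
end

section
/- Let T : M_n(ℂ) → M_n(ℂ) be a linear map that is positive and trace preserving. Then the following are equivalent: (i) ‖T(𝟙)‖_p ≤ n^{1/p} for some p with 1 < p ≤ ∞; (ii) T is unital, i.e. T(𝟙) = 𝟙; (iii) ‖T(A)‖_p ≤ ‖A‖_p for every A ∈ M_n(ℂ) and every 1 ≤ p ≤ ∞; (iv) ‖T(A)‖_p ≤ ‖A‖_p for every A ∈ M_n(ℂ), for some p with 1 < p ≤ ∞. -/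
open scoped ENNReal ComplexOrder

open Matrix

open scoped Matrix.Norms.L2Operator in
theorem unitary_decomp {n : ℕ} (W : Matrix (Fin n) (Fin n) ℂ) (hW : W ∈ unitaryGroup (Fin n) ℂ) :
    ∃ (S : Finset ℂ) (Q : ℂ → Matrix (Fin n) (Fin n) ℂ), (∀ z ∈ S, ‖z‖ ≤ 1) ∧ (∀ z, (Q z).PosSemidef) ∧
      ∑ z ∈ S, Q z = 1 ∧ ∑ z ∈ S, z • Q z = W := by
  have hn : IsStarNormal W := ⟨by
    have h1 := (mem_unitaryGroup_iff (A := W)).1 hW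
    have h2 := (mem_unitaryGroup_iff' (A := W)).1 hW
    rw [Commute, SemiconjBy, h1, h2]⟩
  have hfin : (spectrum ℂ W).Finite := Matrix.finite_spectrum W
  have hc : ∀ f : ℂ → ℂ, ContinuousOn f (spectrum ℂ W) := fun f => hfin.continuousOn f
  refine ⟨hfin.toFinset, fun z => cfc (fun w : ℂ => if w = z then (1:ℂ) else 0) W, ?_, ?_, ?_, ?_⟩
  · intro z hz
    rw [Set.Finite.mem_toFinset] at hz
    have := spectrum.subset_circle_of_unitary (𝕜 := ℂ) hW hz
    simpa using this.le
  · intro z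
    have : cfc (fun w : ℂ => if w = z then (1:ℂ) else 0) W = 
      (cfc (fun w : ℂ => if w = z then (1:ℂ) else 0) W)ᴴ * cfc (fun w : ℂ => if w = z then (1:ℂ) else 0) W := by
      rw [← star_eq_conjTranspose, ← cfc_star, ← cfc_mul _ _ W (hc _) (hc _)]
      congr 1
      ext w
      split_ifs <;> simp
    beta_reduce
    rw [this]
    exact posSemidef_conjTranspose_mul_self _
  · rw [← cfc_sum _ W _ (fun _ _ => hc _), ← cfc_one ℂ W]
    refine cfc_congr fun w hw => ?_
    simp [Finset.sum_apply, hw]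
  · have : ∀ z, z • cfc (fun w : ℂ => if w = z then (1:ℂ) else 0) W = cfc (fun w : ℂ => if w = z then z else 0) W := by
      intro z
      rw [← cfc_smul _ _ W (hc _)]
      congr 1
      ext w
      simp
    simp only [this]
    rw [← cfc_sum _ W _ (fun _ _ => hc _)]
    conv_rhs => rw [← cfc_id ℂ W]
    refine cfc_congr fun w hw => ?_
    simp [Finset.sum_apply, hw]

theorem singularValues_nonneg' {n : ℕ} (A : Matrix (Fin n) (Fin n) ℂ) (i : Fin n) :
    0 ≤ singularValues A i := Real.sqrt_nonneg _

theorem svd_exists {n : ℕ} (A : Matrix (Fin n) (Fin n) ℂ) :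
    ∃ U ∈ unitaryGroup (Fin n) ℂ, ∃ V ∈ unitaryGroup (Fin n) ℂ,
      A = U * diagonal (fun i => (singularValues A i : ℂ)) * Vᴴ := by
  classical
  set hH := (Matrix.posSemidef_conjTranspose_mul_self A).isHermitian with hHdef
  obtain ⟨V, hV⟩ : ∃ V : unitaryGroup (Fin n) ℂ, V = hH.eigenvectorUnitary := ⟨_, rfl⟩
  have hVV : (V : Matrix (Fin n) (Fin n) ℂ) * (V : Matrix (Fin n) (Fin n) ℂ)ᴴ = 1 :=
    mem_unitaryGroup_iff.1 V.2
  have hVV' : (V : Matrix (Fin n) (Fin n) ℂ)ᴴ * (V : Matrix (Fin n) (Fin n) ℂ) = 1 :=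
    mem_unitaryGroup_iff'.1 V.2
  set M := A * (V : Matrix (Fin n) (Fin n) ℂ) with hM
  have hev : ∀ i, ((singularValues A i : ℂ))^2 = (hH.eigenvalues i : ℂ) := by
    intro i
    rw [← Complex.ofReal_pow]
    congr 1
    exact Real.sq_sqrt ((Matrix.posSemidef_conjTranspose_mul_self A).eigenvalues_nonneg i)
  have hMM : Mᴴ * M = diagonal (fun i => (singularValues A i : ℂ)^2) := by
    have h := hH.spectral_theorem
    rw [Unitary.conjStarAlgAut_apply, ← hV] at h
    rw [hM, conjTranspose_mul, Matrix.mul_assoc, ← Matrix.mul_assoc Aᴴ, h]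
    rw [star_eq_conjTranspose]
    simp only [← Matrix.mul_assoc]
    rw [hVV', Matrix.one_mul, Matrix.mul_assoc, hVV', Matrix.mul_one]
    congr 1
    ext i
    simp [hev]
  let w : Fin n → EuclideanSpace ℂ (Fin n) := fun j => WithLp.toLp 2 (fun i => M i j)
  have hw : ∀ i j, inner ℂ (w i) (w j) = if i = j then (singularValues A i : ℂ)^2 else 0 := by
    intro i j
    have := congrFun (congrFun hMM i) j
    rw [diagonal_apply, Matrix.mul_apply] at this
    rw [← this]
    simp [w, PiLp.inner_apply, mul_comm]
  let u : Fin n → EuclideanSpace ℂ (Fin n) := fun j => ((singularValues A j : ℂ))⁻¹ • w j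
  have hu : Orthonormal ℂ (Set.domRestrict {j | singularValues A j ≠ 0} u) := by
    rw [orthonormal_iff_ite]
    rintro ⟨i, hi⟩ ⟨j, hj⟩
    simp only [Set.domRestrict_apply, u, inner_smul_left, inner_smul_right, hw, Subtype.mk.injEq]
    split_ifs with hij
    · subst hij
      have : (singularValues A i : ℂ) ≠ 0 := by exact_mod_cast hi
      simp
      field_simp
    · simp
  obtain ⟨b, hb⟩ := hu.exists_orthonormalBasis_extension_of_card_eq (by simp)
  let U : Matrix (Fin n) (Fin n) ℂ := of fun i j => b j i
  have hU : U ∈ unitaryGroup (Fin n) ℂ := by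
    rw [mem_unitaryGroup_iff']
    ext i j
    have := (orthonormal_iff_ite.1 b.orthonormal) i j
    rw [PiLp.inner_apply] at this
    rw [star_eq_conjTranspose, Matrix.mul_apply, one_apply, ← this]
    simp [U, mul_comm]
  refine ⟨U, hU, V, V.2, ?_⟩
  have key : M = U * diagonal (fun i => (singularValues A i : ℂ)) := by
    ext i j
    rw [mul_diagonal]
    by_cases hj : singularValues A j = 0
    · have h0 : w j = 0 := by
        rw [← inner_self_eq_zero (𝕜 := ℂ), hw]; simp [hj]
      have := congrArg (fun v : EuclideanSpace ℂ (Fin n) => v i) h0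
      simp [w] at this
      simp [hj, this]
    · have h1 := hb j hj
      have : (singularValues A j : ℂ) ≠ 0 := by exact_mod_cast hj
      simp only [U, of_apply, h1, u, w]
      simp
      field_simp
  rw [← key, hM, Matrix.mul_assoc, hVV, Matrix.mul_one]

/-- rank one partial isometries -/
noncomputable def rankOneE {n : ℕ} (U V : Matrix (Fin n) (Fin n) ℂ) (i : Fin n) :
    Matrix (Fin n) (Fin n) ℂ := U * diagonal (Pi.single i 1) * Vᴴ

theorem sum_rankOneE {n : ℕ} (U V : Matrix (Fin n) (Fin n) ℂ) (d : Fin n → ℂ) :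
    U * diagonal d * Vᴴ = ∑ i, d i • rankOneE U V i := by
  unfold rankOneE
  have hsm : ∀ i, d i • (U * diagonal (Pi.single i 1) * Vᴴ) =
      U * (d i • diagonal (Pi.single i 1)) * Vᴴ := by
    intro i
    rw [Matrix.mul_smul, Matrix.smul_mul]
  simp only [hsm]
  rw [← Matrix.sum_mul, ← Matrix.mul_sum]
  congr 2
  ext a b
  simp only [Matrix.sum_apply, Matrix.smul_apply, diagonal_apply]
  split_ifs with h
  · simp [Pi.single_apply]
  · simp

theorem rankOneE_eq {n : ℕ} (U V : Matrix (Fin n) (Fin n) ℂ) (i : Fin n) :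
    rankOneE U V i = vecMulVec (fun a => U a i) (star (fun a => V a i)) := by
  ext a b
  unfold rankOneE
  rw [Matrix.mul_apply]
  simp only [mul_diagonal, vecMulVec_apply, conjTranspose_apply, Pi.star_apply]
  rw [Finset.sum_eq_single i]
  · simp
  · intro c _ hc; simp [hc]
  · simp

theorem trace_mul_nonneg' {n : ℕ} {X Y : Matrix (Fin n) (Fin n) ℂ} (hX : X.PosSemidef)
    (hY : Y.PosSemidef) : 0 ≤ (Y * X).trace := by
  have h := hY.isHermitian.spectral_theorem
  obtain ⟨C, hC⟩ : ∃ C : Matrix (Fin n) (Fin n) ℂ, Y = Cᴴ * C := by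
    open scoped MatrixOrder in
    exact CStarAlgebra.nonneg_iff_eq_star_mul_self.1 hY.nonneg
  rw [hC, Matrix.mul_assoc, trace_mul_comm]
  exact (hX.mul_mul_conjTranspose_same C).trace_nonneg

/-- AM-GM version of Cauchy-Schwarz. -/
theorem amgm {n : ℕ} (φ : Matrix (Fin n) (Fin n) ℂ →ₗ[ℂ] ℂ)
    (hφ : ∀ v : Fin n → ℂ, 0 ≤ φ (vecMulVec v (star v))) (x y : Fin n → ℂ) :
    2 * ‖φ (vecMulVec y (star x))‖ ≤
      (φ (vecMulVec x (star x))).re + (φ (vecMulVec y (star y))).re := by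
  set b := φ (vecMulVec y (star x)) with hb
  set c := φ (vecMulVec x (star y)) with hc
  have hx := hφ x
  have hy := hφ y
  have hexp : ∀ t : ℂ, φ (vecMulVec (y + t • x) (star (y + t • x))) =
      φ (vecMulVec y (star y)) + t * star t * φ (vecMulVec x (star x)) + star t * b + t * c := by
    intro t
    simp only [star_add, star_smul, add_vecMulVec, vecMulVec_add, smul_vecMulVec, vecMulVec_smul,
      map_add, map_smul, smul_eq_mul, smul_add, hb, hc]
    ring
  have h1 := hφ (y + (1:ℂ) • x)
  have h2 := hφ (y + Complex.I • x)
  rw [hexp] at h1 h2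
  rw [Complex.le_def] at hx hy h1 h2
  simp at hx hy h1 h2
  have hcb : c = star b := by
    apply Complex.ext
    · simp; linarith [h2.2, hx.2, hy.2]
    · simp; linarith [h1.2, hx.2, hy.2]
  by_cases hb0 : b = 0
  · rw [hb0]; simp; linarith [hx.1, hy.1]
  have h3 := hφ (y + (-(b / (‖b‖ : ℂ))) • x)
  have hnb : (‖b‖ : ℂ) ≠ 0 := by simpa using hb0
  have hbb : b * star b = (‖b‖ : ℂ)^2 := by
    simpa using Complex.mul_conj' b
  have e1 : (-(b / (‖b‖ : ℂ))) * star (-(b / (‖b‖ : ℂ))) = 1 := by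
    have : (-(b / (‖b‖ : ℂ))) * star (-(b / (‖b‖ : ℂ))) = (b * star b) / (‖b‖ : ℂ)^2 := by
      simp; field_simp
    rw [this, hbb]; field_simp
  have e2 : star (-(b / (‖b‖ : ℂ))) * b = - (‖b‖ : ℂ) := by
    have : star (-(b / (‖b‖ : ℂ))) * b = - ((b * star b) / (‖b‖ : ℂ)) := by
      simp; field_simp
    rw [this, hbb]; field_simp
  have e3 : -(b / (‖b‖ : ℂ)) * c = - (‖b‖ : ℂ) := by
    have : (-(b / (‖b‖ : ℂ))) * c = - ((b * star b) / (‖b‖ : ℂ)) := by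
      rw [hcb]; field_simp
    rw [this, hbb]; field_simp
  rw [hexp, e1, e2, e3, Complex.le_def] at h3
  have := h3.1
  simp at this
  linarith

theorem bilin_unitary {n : ℕ}
    (B : Matrix (Fin n) (Fin n) ℂ →ₗ[ℂ] Matrix (Fin n) (Fin n) ℂ →ₗ[ℂ] ℂ)
    (hpos : ∀ X Y, X.PosSemidef → Y.PosSemidef → 0 ≤ B X Y)
    (hone : ∀ Y, B 1 Y = Y.trace)
    (W : Matrix (Fin n) (Fin n) ℂ) (hW : W ∈ unitaryGroup (Fin n) ℂ)
    (x y : Fin n → ℂ) (hx : star x ⬝ᵥ x = 1) (hy : star y ⬝ᵥ y = 1) :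
    ‖B W (vecMulVec y (star x))‖ ≤ 1 := by
  obtain ⟨S, Q, hS, hQ, hQ1, hQW⟩ := unitary_decomp W hW
  have hsum : ∀ v : Fin n → ℂ, star v ⬝ᵥ v = 1 → 
      ∑ z ∈ S, (B (Q z) (vecMulVec v (star v))).re = 1 := by
    intro v hv
    rw [← Complex.re_sum, ← LinearMap.sum_apply, ← map_sum, hQ1, hone, trace_vecMulVec,
      dotProduct_comm, hv]
    simp
  have h1 : ‖B W (vecMulVec y (star x))‖ ≤ ∑ z ∈ S, ‖B (Q z) (vecMulVec y (star x))‖ := by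
    rw [← hQW, map_sum, LinearMap.sum_apply]
    refine norm_sum_le_of_le _ fun z hz => ?_
    rw [map_smul, LinearMap.smul_apply, norm_smul]
    exact mul_le_of_le_one_left (norm_nonneg _) (hS z hz)
  have h2 : ∑ z ∈ S, 2 * ‖B (Q z) (vecMulVec y (star x))‖ ≤
      ∑ z ∈ S, ((B (Q z) (vecMulVec x (star x))).re + (B (Q z) (vecMulVec y (star y))).re) :=
    Finset.sum_le_sum fun z _ => amgm (B (Q z))
      (fun v => hpos _ _ (hQ z) (posSemidef_vecMulVec_self_star v)) x y
  rw [Finset.sum_add_distrib, hsum x hx, hsum y hy, ← Finset.mul_sum] at h2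
  linarith

theorem col_unit {n : ℕ} {U : Matrix (Fin n) (Fin n) ℂ} (hU : U ∈ unitaryGroup (Fin n) ℂ)
    (j : Fin n) : star (fun a => U a j) ⬝ᵥ (fun a => U a j) = 1 := by
  have := congrFun (congrFun (mem_unitaryGroup_iff'.1 hU) j) j
  rw [Matrix.mul_apply, one_apply_eq] at this
  rw [← this]
  simp [dotProduct]

theorem bilin_row_sum {n : ℕ}
    (B : Matrix (Fin n) (Fin n) ℂ →ₗ[ℂ] Matrix (Fin n) (Fin n) ℂ →ₗ[ℂ] ℂ)
    (hpos : ∀ X Y, X.PosSemidef → Y.PosSemidef → 0 ≤ B X Y)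
    (hone : ∀ Y, B 1 Y = Y.trace)
    {U V X Z : Matrix (Fin n) (Fin n) ℂ} (hU : U ∈ unitaryGroup (Fin n) ℂ)
    (hV : V ∈ unitaryGroup (Fin n) ℂ) (hX : X ∈ unitaryGroup (Fin n) ℂ)
    (hZ : Z ∈ unitaryGroup (Fin n) ℂ) (j : Fin n) :
    ∑ i, ‖B (rankOneE U V i) (rankOneE X Z j)‖ ≤ 1 := by
  have hth : ∀ z : ℂ, ∃ t : ℂ, t * star t = 1 ∧ t * z = ‖z‖ := by
    intro z
    by_cases hz : z = 0
    · exact ⟨1, by simp, by simp [hz]⟩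
    · have hnb : (‖z‖ : ℂ) ≠ 0 := by simpa using hz
      have hbb : z * star z = (‖z‖ : ℂ)^2 := by
        simpa using Complex.mul_conj' z
      refine ⟨star z / ‖z‖, ?_, ?_⟩
      · have : star z / ‖z‖ * star (star z / (‖z‖ : ℂ)) = (z * star z) / (‖z‖ : ℂ)^2 := by
          simp; field_simp
        rw [this, hbb]; field_simp
      · have : star z / ‖z‖ * z = (z * star z) / (‖z‖ : ℂ) := by
          field_simp
        rw [this, hbb]; field_simp
  choose t ht1 ht2 using fun i => hth (B (rankOneE U V i) (rankOneE X Z j))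
  have hD : diagonal t ∈ unitaryGroup (Fin n) ℂ := by
    rw [mem_unitaryGroup_iff, star_eq_conjTranspose, diagonal_conjTranspose, diagonal_mul_diagonal,
      ← diagonal_one]
    congr 1
    ext i
    exact ht1 i
  have hW : U * diagonal t * Vᴴ ∈ unitaryGroup (Fin n) ℂ :=
    mul_mem (mul_mem hU hD) (Unitary.star_mem hV)
  have h := bilin_unitary B hpos hone _ hW (fun a => Z a j) (fun a => X a j) (col_unit hZ j)
    (col_unit hX j)
  rw [← rankOneE_eq, sum_rankOneE, map_sum, LinearMap.sum_apply] at h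
  simp only [map_smul, LinearMap.smul_apply, smul_eq_mul, ht2] at h
  rw [← Complex.ofReal_sum, Complex.norm_real, Real.norm_of_nonneg
    (Finset.sum_nonneg fun i _ => norm_nonneg _)] at h
  exact h

theorem singular_substochastic {n : ℕ}
    (T : Matrix (Fin n) (Fin n) ℂ →ₗ[ℂ] Matrix (Fin n) (Fin n) ℂ)
    (hTpos : IsPositiveMatrixMap T) (hTtr : IsTracePreservingMap T) (h1 : T 1 = 1)
    (A : Matrix (Fin n) (Fin n) ℂ) :
    ∃ c : Fin n → Fin n → ℝ, (∀ i j, 0 ≤ c i j) ∧ (∀ j, ∑ i, c i j ≤ 1) ∧ (∀ i, ∑ j, c i j ≤ 1) ∧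
      ∀ j, singularValues (T A) j ≤ ∑ i, c i j * singularValues A i := by
  let B : Matrix (Fin n) (Fin n) ℂ →ₗ[ℂ] Matrix (Fin n) (Fin n) ℂ →ₗ[ℂ] ℂ :=
    LinearMap.mk₂ ℂ (fun X Y => (Y * T X).trace)
      (by intro a b c; simp [Matrix.mul_add])
      (by intro a b c; simp)
      (by intro a b c; simp [Matrix.add_mul])
      (by intro a b c; simp)
  have hB : ∀ X Y, B X Y = (Y * T X).trace := fun X Y => rfl
  have hpos : ∀ X Y, X.PosSemidef → Y.PosSemidef → 0 ≤ B X Y := fun X Y hX hY =>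
    trace_mul_nonneg' (hTpos X hX) hY
  obtain ⟨U, hU, V, hV, hA⟩ := svd_exists A
  obtain ⟨X, hX, Z, hZ, hTA⟩ := svd_exists (T A)
  refine ⟨fun i j => ‖B (rankOneE U V i) (rankOneE Z X j)‖, fun i j => norm_nonneg _, ?_, ?_, ?_⟩
  · intro j
    exact bilin_row_sum B hpos (fun Y => by rw [hB, h1, Matrix.mul_one]) hU hV hZ hX j
  · intro i
    exact bilin_row_sum B.flip (fun X Y hX hY => hpos Y X hY hX)
      (fun Y => by rw [LinearMap.flip_apply, hB, Matrix.one_mul, hTtr]) hZ hX hU hV i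
  · intro j
    have e1 : B A (rankOneE Z X j) = (singularValues (T A) j : ℂ) := by
      rw [hB]
      conv_lhs => rw [hTA]
      unfold rankOneE
      have hXX : Xᴴ * X = 1 := mem_unitaryGroup_iff'.1 hX
      have hZZ : Zᴴ * Z = 1 := mem_unitaryGroup_iff'.1 hZ
      have : Z * diagonal (Pi.single j 1) * Xᴴ *
          (X * diagonal (fun i => (singularValues (T A) i : ℂ)) * Zᴴ) =
          Z * (diagonal (Pi.single j 1) * diagonal (fun i => (singularValues (T A) i : ℂ))) * Zᴴ := by
        calc _ = Z * diagonal (Pi.single j 1) * (Xᴴ * X) *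
              diagonal (fun i => (singularValues (T A) i : ℂ)) * Zᴴ := by
              simp only [Matrix.mul_assoc]
          _ = _ := by rw [hXX, Matrix.mul_one]; simp only [Matrix.mul_assoc]
      rw [this, trace_mul_comm, ← Matrix.mul_assoc, hZZ, Matrix.one_mul, diagonal_mul_diagonal,
        trace_diagonal]
      simp [Pi.single_apply]
    have e2 : B A (rankOneE Z X j) =
        ∑ i, (singularValues A i : ℂ) * B (rankOneE U V i) (rankOneE Z X j) := by
      conv_lhs => rw [hA, sum_rankOneE, map_sum, LinearMap.sum_apply]
      simp
    have e3 : singularValues (T A) j = ‖B A (rankOneE Z X j)‖ := by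
      rw [e1, Complex.norm_real, Real.norm_of_nonneg (singularValues_nonneg' _ _)]
    rw [e3, e2]
    refine norm_sum_le_of_le _ fun i _ => ?_
    rw [norm_mul, Complex.norm_real, Real.norm_of_nonneg (singularValues_nonneg' _ _), mul_comm]

theorem contractive_of_unital {n : ℕ}
    (T : Matrix (Fin n) (Fin n) ℂ →ₗ[ℂ] Matrix (Fin n) (Fin n) ℂ)
    (hTpos : IsPositiveMatrixMap T) (hTtr : IsTracePreservingMap T) (h1 : T 1 = 1)
    (p : ℝ≥0∞) (hp : 1 ≤ p) (A : Matrix (Fin n) (Fin n) ℂ) :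
    schattenNorm p (T A) ≤ schattenNorm p A := by
  obtain ⟨c, hc0, hcol, hrow, ht⟩ := singular_substochastic T hTpos hTtr h1 A
  have hs := singularValues_nonneg' A
  have htn := singularValues_nonneg' (T A)
  unfold schattenNorm
  split_ifs with hpt
  · have hbdd : BddAbove (Set.range (singularValues A)) := Set.finite_range _ |>.bddAbove
    refine Real.iSup_le (fun j => ?_) (Real.iSup_nonneg hs)
    calc singularValues (T A) j ≤ ∑ i, c i j * singularValues A i := ht j
      _ ≤ ∑ i, c i j * (⨆ i, singularValues A i) := Finset.sum_le_sum fun i _ =>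
          mul_le_mul_of_nonneg_left (le_ciSup hbdd i) (hc0 i j)
      _ = (∑ i, c i j) * (⨆ i, singularValues A i) := by rw [Finset.sum_mul]
      _ ≤ _ := mul_le_of_le_one_left (Real.iSup_nonneg hs) (hcol j)
  · have hq : 1 ≤ p.toReal := by
      simpa using ENNReal.toReal_mono hpt hp
    set q := p.toReal
    have hq0 : 0 < q := by linarith
    refine Real.rpow_le_rpow (Finset.sum_nonneg fun j _ => Real.rpow_nonneg (htn j) _) ?_
      (by positivity)
    have hsq : ∀ i, 0 ≤ singularValues A i ^ q := fun i => Real.rpow_nonneg (hs i) _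
    have step : ∀ j, singularValues (T A) j ^ q ≤ ∑ i, c i j * singularValues A i ^ q := by
      intro j
      have hn : 0 ≤ ∑ i, c i j * singularValues A i ^ q :=
        Finset.sum_nonneg fun i _ => mul_nonneg (hc0 i j) (hsq i)
      have h := Real.inner_le_weight_mul_Lp_of_nonneg Finset.univ hq (fun i => c i j)
        (singularValues A) (fun i => hc0 i j) hs
      have h2 : (∑ i, c i j) ^ (1 - q⁻¹) ≤ 1 :=
        Real.rpow_le_one (Finset.sum_nonneg fun i _ => hc0 i j) (hcol j)
          (by have := inv_le_one_of_one_le₀ hq; linarith)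
      have h3 : singularValues (T A) j ≤ (∑ i, c i j * singularValues A i ^ q) ^ q⁻¹ :=
        (ht j).trans (h.trans (mul_le_of_le_one_left (Real.rpow_nonneg hn _) h2))
      calc _ ≤ ((∑ i, c i j * singularValues A i ^ q) ^ q⁻¹) ^ q :=
            Real.rpow_le_rpow (htn j) h3 hq0.le
        _ = _ := Real.rpow_inv_rpow hn hq0.ne'
    calc _ ≤ ∑ j, ∑ i, c i j * singularValues A i ^ q := Finset.sum_le_sum fun j _ => step j
      _ = ∑ i, (∑ j, c i j) * singularValues A i ^ q := by
          rw [Finset.sum_comm]; simp only [Finset.sum_mul]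
      _ ≤ _ := Finset.sum_le_sum fun i _ => mul_le_of_le_one_left (hsq i) (hrow i)

theorem singularValues_one {n : ℕ} (i : Fin n) :
    singularValues (1 : Matrix (Fin n) (Fin n) ℂ) i = 1 := by
  have hH := (Matrix.posSemidef_conjTranspose_mul_self (1 : Matrix (Fin n) (Fin n) ℂ)).isHermitian
  have h := hH.eigenvalues_mem_spectrum_real i
  have : Nontrivial (Matrix (Fin n) (Fin n) ℂ) := by
    haveI : Nonempty (Fin n) := ⟨i⟩
    infer_instance
  have e : ((1 : Matrix (Fin n) (Fin n) ℂ)ᴴ * 1) = 1 := by simp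
  have h' : hH.eigenvalues i ∈ spectrum ℝ (1 : Matrix (Fin n) (Fin n) ℂ) := by
    simpa only [e] using h
  rw [spectrum.one_eq, Set.mem_singleton_iff] at h'
  unfold singularValues
  rw [h', Real.sqrt_one]

theorem schattenNorm_one_le {n : ℕ} (p : ℝ≥0∞) :
    schattenNorm p (1 : Matrix (Fin n) (Fin n) ℂ) ≤ (n : ℝ) ^ ((1 : ℝ) / p.toReal) := by
  unfold schattenNorm
  simp only [singularValues_one]
  split_ifs with h
  · subst h
    simp
    exact Real.iSup_le (fun _ => le_rfl) zero_le_one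
  · simp

theorem unital_of_norm {n : ℕ} (A : Matrix (Fin n) (Fin n) ℂ) (hA : A.PosSemidef)
    (htr : A.trace = n) (p : ℝ≥0∞) (hp : 1 < p)
    (h : schattenNorm p A ≤ (n : ℝ) ^ ((1 : ℝ) / p.toReal)) : A = 1 := by
  have hs := singularValues_nonneg' A
  obtain ⟨U, hU, V, hV, hA'⟩ := svd_exists A
  have hsum : (n : ℝ) ≤ ∑ i, singularValues A i := by
    have hW : Vᴴ * U ∈ unitaryGroup (Fin n) ℂ := mul_mem (Unitary.star_mem hV) hU
    have e : A.trace = ∑ i, (Vᴴ * U) i i * (singularValues A i : ℂ) := by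
      conv_lhs => rw [hA', trace_mul_comm, ← Matrix.mul_assoc]
      simp [Matrix.trace, mul_diagonal]
    have e2 : (n : ℝ) = ‖A.trace‖ := by rw [htr]; simp
    rw [e2, e]
    refine norm_sum_le_of_le _ fun i _ => ?_
    rw [norm_mul, Complex.norm_real, Real.norm_of_nonneg (hs i)]
    exact mul_le_of_le_one_left (hs i) (entry_norm_bound_of_unitary hW i i)
  have hone : ∀ i, singularValues A i = 1 := by
    unfold schattenNorm at h
    split_ifs at h with hpt
    · subst hpt
      simp at h
      have hle : ∀ i, singularValues A i ≤ 1 := fun i =>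
        (le_ciSup (Set.finite_range _).bddAbove i).trans h
      have heq : ∑ i, singularValues A i = ∑ _i : Fin n, (1 : ℝ) :=
        le_antisymm (Finset.sum_le_sum fun i _ => hle i) (by simpa using hsum)
      intro i
      exact (Finset.sum_eq_sum_iff_of_le fun i _ => hle i).1 heq i (Finset.mem_univ i)
    · have hq : 1 < p.toReal := by
        simpa using (ENNReal.toReal_lt_toReal ENNReal.one_ne_top hpt).2 hp
      set q := p.toReal
      have hq0 : 0 < q := by linarith
      have h' : ∑ i, singularValues A i ^ q ≤ n := by
        refine (Real.rpow_le_rpow_iff (Finset.sum_nonneg fun i _ => Real.rpow_nonneg (hs i) _)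
          (Nat.cast_nonneg n) (by positivity : 0 < 1 / q)).1 h
      have hb : ∀ i, 1 + q * (singularValues A i - 1) ≤ singularValues A i ^ q := fun i => by
        have := one_add_mul_self_le_rpow_one_add (s := singularValues A i - 1)
          (by linarith [hs i]) hq.le
        simpa using this
      have hsum2 : (n : ℝ) ≤ ∑ i, (1 + q * (singularValues A i - 1)) := by
        rw [Finset.sum_add_distrib, ← Finset.mul_sum, Finset.sum_sub_distrib]
        simp
        nlinarith
      have heq : ∑ i, (1 + q * (singularValues A i - 1)) = ∑ i, singularValues A i ^ q :=
        le_antisymm (Finset.sum_le_sum fun i _ => hb i) (h'.trans hsum2)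
      intro i
      have hi := (Finset.sum_eq_sum_iff_of_le fun i _ => hb i).1 heq i (Finset.mem_univ i)
      by_contra hne
      have := one_add_mul_self_lt_rpow_one_add (s := singularValues A i - 1)
          (by linarith [hs i]) (sub_ne_zero.2 hne) hq
      simp at this
      linarith
  have hAA : Aᴴ * A = 1 := by
    have e : A = U * Vᴴ := by
      rw [hA']
      conv_lhs => simp only [hone]
      simp
    have hW : U * Vᴴ ∈ unitaryGroup (Fin n) ℂ := mul_mem hU (Unitary.star_mem hV)
    rw [e]
    exact mem_unitaryGroup_iff'.1 hW
  have hAh : Aᴴ = A := hA.isHermitian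
  rw [← sub_eq_zero, ← trace_conjTranspose_mul_self_eq_zero_iff]
  have : (A - 1)ᴴ * (A - 1) = Aᴴ * A - A - A + 1 := by
    rw [conjTranspose_sub, hAh, conjTranspose_one]; noncomm_ring
  rw [this, hAA]
  simp [htr]

/-- **Theorem 3.** For a positive trace preserving `T : M_n(ℂ) → M_n(ℂ)` the following are
equivalent: (i) `‖T(𝟙)‖_p ≤ n^{1/p}` for some `1 < p ≤ ∞`; (ii) `T` is unital;
(iii) `T` is a `p`-norm contraction for every `1 ≤ p ≤ ∞`; (iv) `T` is a `p`-norm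
contraction for some `1 < p ≤ ∞`.  (Here `1/∞ = 0`.) -/
theorem unital_tfae_contractive
    (n : ℕ) (T : Matrix (Fin n) (Fin n) ℂ →ₗ[ℂ] Matrix (Fin n) (Fin n) ℂ)
    (hTpos : IsPositiveMatrixMap T) (hTtr : IsTracePreservingMap T) :
    List.TFAE
      [ ∃ p : ℝ≥0∞, 1 < p ∧
          schattenNorm p (T 1) ≤ (n : ℝ) ^ ((1 : ℝ) / p.toReal),
        T 1 = 1,
        ∀ p : ℝ≥0∞, 1 ≤ p → ∀ A : Matrix (Fin n) (Fin n) ℂ,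
          schattenNorm p (T A) ≤ schattenNorm p A,
        ∃ p : ℝ≥0∞, 1 < p ∧ ∀ A : Matrix (Fin n) (Fin n) ℂ,
          schattenNorm p (T A) ≤ schattenNorm p A ] := by
  tfae_have 2 → 3 := fun h p hp A => contractive_of_unital T hTpos hTtr h p hp A
  tfae_have 3 → 4 := fun h => ⟨2, by norm_num, fun A => h 2 (by norm_num) A⟩
  tfae_have 4 → 1 := fun ⟨p, hp, h⟩ => ⟨p, hp, (h 1).trans (schattenNorm_one_le p)⟩
  tfae_have 1 → 2 := fun ⟨p, hp, h⟩ =>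
    unital_of_norm (T 1) (hTpos 1 PosSemidef.one) (by rw [hTtr]; simp) p hp h
  tfae_finish
end

section
/- Let n be odd, 1 ≤ p < ∞, and let T : M_n(ℂ) → M_n(ℂ) be a positive trace preserving linear map. Then for every Hermitian A ∈ M_n(ℂ) with tr A = 0, ‖T(A)‖_p ≤ (2^{2-p} / ((n-1)^{1-p} + (n+1)^{1-p}))^{1/p} ‖A‖_p. -/
open scoped ENNReal ComplexOrder

open Matrix in
lemma aux_sum_sing {n : ℕ} (A : Matrix (Fin n) (Fin n) ℂ) (hA : A.IsHermitian) (p : ℝ) :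
    ∑ i, singularValues A i ^ p = ∑ i, |hA.eigenvalues i| ^ p := by
  have h1 := (Matrix.posSemidef_conjTranspose_mul_self A).isHermitian.roots_charpoly_eq_eigenvalues
  have h2 : (Aᴴ * A).charpoly = (diagonal (fun i => ((hA.eigenvalues i ^ 2 : ℝ) : ℂ))).charpoly := by
    rw [hA.eq]
    conv_lhs => rw [hA.spectral_theorem, ← map_mul, Unitary.conjStarAlgAut_apply,
      charpoly_mul_comm, ← mul_assoc]
    simp [Matrix.diagonal_mul_diagonal, pow_two]
  rw [h2, Matrix.charpoly_diagonal, Polynomial.roots_prod _ _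
    (Finset.prod_ne_zero_iff.2 fun i _ => Polynomial.X_sub_C_ne_zero _)] at h1
  simp only [Polynomial.roots_X_sub_C, Multiset.bind_singleton] at h1
  have h3 := congrArg (fun s : Multiset ℂ => (s.map (fun z => Real.sqrt z.re ^ p)).sum) h1
  simp only [Multiset.map_map, Function.comp_def, Complex.ofReal_re, Real.sqrt_sq_eq_abs] at h3
  unfold singularValues
  exact h3.symm

lemma aux_convex (q : ℝ) : ConvexOn ℝ (Set.Ioi 0) (fun x : ℝ => x ^ (-q)) ∨ q < 0 := by
  by_cases hq : q < 0
  · exact Or.inr hq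
  left
  push Not at hq
  refine ⟨convex_Ioi 0, ?_⟩
  intro x hx y hy a b ha hb hab
  have hx' : (0 : ℝ) < x := hx
  have hy' : (0 : ℝ) < y := hy
  have hz : 0 < a • x + b • y := (convex_Ioi (0 : ℝ)) hx hy ha hb hab
  have hlog := strictConcaveOn_log_Ioi.concaveOn.2 hx hy ha hb hab
  have hexp := convexOn_exp.2 (Set.mem_univ (Real.log x * (-q))) (Set.mem_univ (Real.log y * (-q)))
    ha hb hab
  simp only [Real.rpow_def_of_pos hz, Real.rpow_def_of_pos hx', Real.rpow_def_of_pos hy']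
  refine le_trans (Real.exp_le_exp.2 ?_) hexp
  simp only [smul_eq_mul] at *
  nlinarith

lemma aux_k (q : ℝ) (hq : 0 ≤ q) (m k : ℝ) (hk : 0 < k) (hkm : k ≤ m) :
    m ^ (-q) + (m + 1) ^ (-q) ≤ k ^ (-q) + (2 * m + 1 - k) ^ (-q) := by
  have hc := (aux_convex q).resolve_right (by linarith)
  have hd : 0 < 2 * m + 1 - 2 * k := by linarith
  have hd' := hd.ne'
  have hl : 0 < 2 * m + 1 - k := by linarith
  have ha : 0 ≤ (m + 1 - k) / (2 * m + 1 - 2 * k) := div_nonneg (by linarith) hd.le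
  have hb : 0 ≤ (m - k) / (2 * m + 1 - 2 * k) := div_nonneg (by linarith) hd.le
  have hab : (m + 1 - k) / (2 * m + 1 - 2 * k) + (m - k) / (2 * m + 1 - 2 * k) = 1 := by
    rw [← add_div, div_eq_one_iff_eq hd']; ring
  have h1 := hc.2 hk hl ha hb hab
  have h2 := hc.2 hk hl hb ha (by rw [add_comm]; exact hab)
  have e1 : (m + 1 - k) / (2 * m + 1 - 2 * k) * k
      + (m - k) / (2 * m + 1 - 2 * k) * (2 * m + 1 - k) = m := by
    rw [div_mul_eq_mul_div, div_mul_eq_mul_div, ← add_div, div_eq_iff hd']; ring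
  have e2 : (m - k) / (2 * m + 1 - 2 * k) * k
      + (m + 1 - k) / (2 * m + 1 - 2 * k) * (2 * m + 1 - k) = m + 1 := by
    rw [div_mul_eq_mul_div, div_mul_eq_mul_div, ← add_div, div_eq_iff hd']; ring
  simp only [smul_eq_mul] at h1 h2
  rw [e1] at h1
  rw [e2] at h2
  generalize (m + 1 - k) / (2 * m + 1 - 2 * k) = a at *
  generalize (m - k) / (2 * m + 1 - 2 * k) = b at *
  calc _ ≤ _ := add_le_add h1 h2
    _ = (a + b) * (k ^ (-q) + (2 * m + 1 - k) ^ (-q)) := by ring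
    _ = _ := by rw [hab, one_mul]

lemma aux_k2 (q : ℝ) (hq : 0 ≤ q) (m k l : ℕ) (hk : 0 < k) (hl : 0 < l) (h : k + l = 2 * m + 1) :
    (m : ℝ) ^ (-q) + ((m : ℝ) + 1) ^ (-q) ≤ (k : ℝ) ^ (-q) + (l : ℝ) ^ (-q) := by
  have hr : (k : ℝ) + l = 2 * m + 1 := by exact_mod_cast h
  have hk' : (0 : ℝ) < k := by exact_mod_cast hk
  have hl' : (0 : ℝ) < l := by exact_mod_cast hl
  rcases le_or_gt k m with hkm | hkm
  · have := aux_k q hq m k hk' (by exact_mod_cast hkm)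
    rwa [show 2 * (m : ℝ) + 1 - k = l by linarith] at this
  · have hlm : l ≤ m := by omega
    have := aux_k q hq m l hl' (by exact_mod_cast hlm)
    rw [show 2 * (m : ℝ) + 1 - l = k by linarith] at this
    linarith

lemma aux_jensen {ι : Type*} (s : Finset ι) (f : ι → ℝ) (p t : ℝ) (hp : 1 ≤ p)
    (hs : 0 < s.card) (ht : ∑ i ∈ s, |f i| = t) :
    (s.card : ℝ) ^ (-(p - 1)) * t ^ p ≤ ∑ i ∈ s, |f i| ^ p := by
  have := Real.rpow_sum_le_const_mul_sum_rpow s f hp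
  rw [ht] at this
  have hs' : (0 : ℝ) < s.card := by exact_mod_cast hs
  rw [Real.rpow_neg hs'.le, inv_mul_le_iff₀ (Real.rpow_pos_of_pos hs' _)]
  exact this

lemma aux_lower (m : ℕ) (a : Fin (2 * m + 1) → ℝ) (p t : ℝ) (hp : 1 ≤ p) (ha : ∑ i, a i = 0)
    (ht : ∑ i, max (a i) 0 = t) :
    ((m : ℝ) ^ (-(p - 1)) + ((m : ℝ) + 1) ^ (-(p - 1))) * t ^ p ≤ ∑ i, |a i| ^ p := by
  have ht0 : 0 ≤ t := by rw [← ht]; exact Finset.sum_nonneg fun i _ => le_max_right _ _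
  rcases ht0.eq_or_lt with h0 | h0
  · rw [← h0, Real.zero_rpow (by linarith), mul_zero]
    exact Finset.sum_nonneg fun i _ => by positivity
  set s := Finset.univ.filter (fun i => 0 < a i) with hs
  set r := Finset.univ.filter (fun i => ¬ 0 < a i) with hr
  have hcard : s.card + r.card = 2 * m + 1 := by
    have := Finset.card_filter_add_card_filter_not (s := (Finset.univ : Finset (Fin (2 * m + 1))))
      (fun i => 0 < a i)
    rw [Finset.card_univ, Fintype.card_fin] at this
    exact this
  have hsplit := fun f : Fin (2 * m + 1) → ℝ =>
    Finset.sum_filter_add_sum_filter_not Finset.univ (fun i => 0 < a i) f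
  have hs1 : ∑ i ∈ s, |a i| = t := by
    rw [← ht, ← hsplit (fun i => max (a i) 0), ← hs, ← hr]
    rw [Finset.sum_eq_zero (s := r), add_zero]
    · refine Finset.sum_congr rfl fun i hi => ?_
      have : 0 < a i := (Finset.mem_filter.1 hi).2
      rw [abs_of_pos this, max_eq_left this.le]
    · intro i hi
      exact max_eq_right (not_lt.1 (Finset.mem_filter.1 hi).2)
  have hs2 : ∑ i ∈ s, a i = t := by
    rw [← hs1]
    exact Finset.sum_congr rfl fun i hi => (abs_of_pos (Finset.mem_filter.1 hi).2).symm
  have hr1 : ∑ i ∈ r, |a i| = t := by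
    have h1 := hsplit a
    rw [← hs, ← hr, hs2, ha] at h1
    have : ∑ i ∈ r, |a i| = - ∑ i ∈ r, a i := by
      rw [← Finset.sum_neg_distrib]
      exact Finset.sum_congr rfl fun i hi => abs_of_nonpos (not_lt.1 (Finset.mem_filter.1 hi).2)
    linarith
  have hsc : 0 < s.card := by
    rw [Finset.card_pos, Finset.nonempty_iff_ne_empty]
    intro h; rw [h] at hs1; simp at hs1; linarith
  have hrc : 0 < r.card := by
    rw [Finset.card_pos, Finset.nonempty_iff_ne_empty]
    intro h; rw [h] at hr1; simp at hr1; linarith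
  have j1 := aux_jensen s a p t hp hsc hs1
  have j2 := aux_jensen r a p t hp hrc hr1
  have hk := aux_k2 (p - 1) (by linarith) m _ _ hsc hrc hcard
  rw [← hsplit (fun i => |a i| ^ p), ← hs, ← hr]
  have := mul_le_mul_of_nonneg_right hk (Real.rpow_nonneg ht0 p)
  linarith

lemma aux_pow_sum {ι : Type*} [Fintype ι] (b : ι → ℝ) (p t : ℝ) (hp : 1 ≤ p)
    (hb : ∀ i, 0 ≤ b i) (ht : ∑ i, b i = t) : ∑ i, b i ^ p ≤ t ^ p := by
  have ht0 : 0 ≤ t := by rw [← ht]; exact Finset.sum_nonneg fun i _ => hb i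
  have hmul : ∀ x : ℝ, 0 ≤ x → x ^ p = x * x ^ (p - 1) := by
    intro x hx
    rw [← Real.rpow_one_add' hx (by linarith)]; congr 1; ring
  rw [hmul t ht0]
  conv_rhs => rw [← ht, Finset.sum_mul, ht]
  refine Finset.sum_le_sum fun i _ => ?_
  rw [hmul _ (hb i)]
  refine mul_le_mul_of_nonneg_left (Real.rpow_le_rpow (hb i) ?_ (by linarith)) (hb i)
  rw [← ht]
  exact Finset.single_le_sum (fun j _ => hb j) (Finset.mem_univ i)

open Matrix in
lemma aux_upper {n : ℕ} (X B C : Matrix (Fin n) (Fin n) ℂ) (hX : X.IsHermitian) (p t : ℝ)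
    (hp : 1 ≤ p) (hB : B.PosSemidef) (hC : C.PosSemidef) (h : X = B - C)
    (hBt : B.trace = t) (hCt : C.trace = t) :
    ∑ i, |hX.eigenvalues i| ^ p ≤ 2 * t ^ p := by
  set U : Matrix (Fin n) (Fin n) ℂ := (hX.eigenvectorUnitary : Matrix (Fin n) (Fin n) ℂ) with hU
  have hUU : U * Uᴴ = 1 := Unitary.coe_mul_star_self hX.eigenvectorUnitary
  have key : ∀ M : Matrix (Fin n) (Fin n) ℂ, M.PosSemidef → M.trace = t →
      (∀ i, 0 ≤ ((Uᴴ * M * U) i i).re) ∧ ∑ i, ((Uᴴ * M * U) i i).re = t := by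
    intro M hM hMt
    have hp := hM.conjTranspose_mul_mul_same U
    refine ⟨fun i => (Complex.le_def.1 (hp.diag_nonneg (i := i))).1, ?_⟩
    have : (Uᴴ * M * U).trace = t := by
      rw [Matrix.trace_mul_comm, ← mul_assoc, hUU, one_mul, hMt]
    have := congrArg Complex.re this
    simpa [Matrix.trace] using this
  obtain ⟨hb, hbt⟩ := key B hB hBt
  obtain ⟨hc, hct⟩ := key C hC hCt
  have hd : ∀ i, hX.eigenvalues i = ((Uᴴ * B * U) i i).re - ((Uᴴ * C * U) i i).re := by
    intro i
    have h1 := hX.conjStarAlgAut_star_eigenvectorUnitary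
    rw [Unitary.conjStarAlgAut_star_apply] at h1
    have h2 : Uᴴ * X * U = diagonal (RCLike.ofReal ∘ hX.eigenvalues) := h1
    have h3 : Uᴴ * X * U = Uᴴ * B * U - Uᴴ * C * U := by
      rw [← Matrix.sub_mul, ← Matrix.mul_sub, ← h]
    have h4 := congrArg Complex.re (congrFun (congrFun (h2.symm.trans h3) i) i)
    simpa using h4
  have e1 := aux_pow_sum _ p t hp hb hbt
  have e2 := aux_pow_sum _ p t hp hc hct
  have : ∑ i, |hX.eigenvalues i| ^ p ≤
      ∑ i, (((Uᴴ * B * U) i i).re ^ p + ((Uᴴ * C * U) i i).re ^ p) := by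
    refine Finset.sum_le_sum fun i _ => ?_
    rw [hd i]
    have hb := hb i
    have hc := hc i
    generalize ((Uᴴ * B * U) i i).re = x at *
    generalize ((Uᴴ * C * U) i i).re = y at *
    have hx := Real.rpow_nonneg hb p
    have hy := Real.rpow_nonneg hc p
    rcases le_total x y with hxy | hxy
    · have := Real.rpow_le_rpow (abs_nonneg (x - y)) (z := p) (y := y)
        (by rw [abs_of_nonpos (by linarith)]; linarith) (by linarith)
      linarith
    · have := Real.rpow_le_rpow (abs_nonneg (x - y)) (z := p) (y := x)
        (by rw [abs_of_nonneg (by linarith)]; linarith) (by linarith)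
      linarith
  rw [Finset.sum_add_distrib] at this
  linarith

open Matrix in
lemma aux_decomp {n : ℕ} (A : Matrix (Fin n) (Fin n) ℂ) (hA : A.IsHermitian)
    (hA0 : A.trace = 0) : ∃ P N : Matrix (Fin n) (Fin n) ℂ, P.PosSemidef ∧ N.PosSemidef ∧
      A = P - N ∧ P.trace = ((∑ i, max (hA.eigenvalues i) 0 : ℝ) : ℂ) ∧ N.trace = P.trace := by
  set U : Matrix (Fin n) (Fin n) ℂ := (hA.eigenvectorUnitary : Matrix (Fin n) (Fin n) ℂ) with hU
  have hUU : Uᴴ * U = 1 := Unitary.coe_star_mul_self hA.eigenvectorUnitary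
  have hpsd : ∀ d : Fin n → ℝ, (∀ i, 0 ≤ d i) →
      (U * diagonal (fun i => (d i : ℂ)) * Uᴴ).PosSemidef := by
    intro d hd
    refine PosSemidef.mul_mul_conjTranspose_same ?_ U
    exact PosSemidef.diagonal (fun i => by simpa using hd i)
  have hAeq : A = U * diagonal (fun i => ((max (hA.eigenvalues i) 0 : ℝ) : ℂ)) * Uᴴ
      - U * diagonal (fun i => ((max (-hA.eigenvalues i) 0 : ℝ) : ℂ)) * Uᴴ := by
    rw [← Matrix.sub_mul, ← Matrix.mul_sub, Matrix.diagonal_sub]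
    conv_lhs => rw [hA.spectral_theorem, Unitary.conjStarAlgAut_apply]
    change U * _ * Uᴴ = _
    congr 3
    ext i
    simp only [Function.comp]
    rw [← Complex.ofReal_sub]
    change ((hA.eigenvalues i : ℝ) : ℂ) = _
    congr 1
    rcases le_total (hA.eigenvalues i) 0 with h | h
    · rw [max_eq_right h, max_eq_left (by linarith)]; ring
    · rw [max_eq_left h, max_eq_right (by linarith)]; ring
  refine ⟨_, _, hpsd _ fun i => le_max_right _ _, hpsd _ fun i => le_max_right _ _, hAeq, ?_, ?_⟩
  · rw [Matrix.trace_mul_comm, ← mul_assoc, hUU, one_mul]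
    simp [Matrix.trace]
  · rw [hAeq, Matrix.trace_sub, sub_eq_zero] at hA0
    exact hA0.symm

/-- **Theorem 4, odd case.** Let `n` be odd, `1 ≤ p < ∞`, and `T : M_n(ℂ) → M_n(ℂ)` a
positive trace preserving map.  Then for every traceless Hermitian `A`,
`‖T(A)‖_p ≤ (2^{2-p} / ((n-1)^{1-p} + (n+1)^{1-p}))^{1/p} ‖A‖_p`. -/
theorem schattenNorm_traceless_bound_odd
    (n : ℕ) (hn : Odd n) (p : ℝ) (hp : 1 ≤ p)
    (T : Matrix (Fin n) (Fin n) ℂ →ₗ[ℂ] Matrix (Fin n) (Fin n) ℂ)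
    (hTpos : IsPositiveMatrixMap T) (hTtr : IsTracePreservingMap T)
    (A : Matrix (Fin n) (Fin n) ℂ) (hA : A.IsHermitian) (hA0 : A.trace = 0) :
    schattenNorm (ENNReal.ofReal p) (T A)
      ≤ ((2 : ℝ) ^ (2 - p) / (((n : ℝ) - 1) ^ (1 - p) + ((n : ℝ) + 1) ^ (1 - p))) ^ (1 / p)
          * schattenNorm (ENNReal.ofReal p) A := by
  have hn' := hn
  obtain ⟨m, rfl⟩ := hn'
  obtain ⟨P, N, hP, hN, hPN, hPt, hNt⟩ := aux_decomp A hA hA0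
  have hTA : T A = T P - T N := by rw [← map_sub, ← hPN]
  have hTP := hTpos P hP
  have hTN := hTpos N hN
  have hX : (T A).IsHermitian := by rw [hTA]; exact hTP.isHermitian.sub hTN.isHermitian
  set t : ℝ := ∑ i, max (hA.eigenvalues i) 0 with ht
  have hup := aux_upper (T A) (T P) (T N) hX p t hp hTP hTN hTA
    (by rw [hTtr, hPt]) (by rw [hTtr, hNt, hPt])
  have hsum : ∑ i, hA.eigenvalues i = 0 := by
    have := hA.trace_eq_sum_eigenvalues
    rw [hA0] at this
    have := congrArg Complex.re this
    simpa using this.symm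
  have hlow := aux_lower m hA.eigenvalues p t hp hsum rfl
  have hp0 : 0 < p := by linarith
  have hne : ENNReal.ofReal p ≠ ⊤ := ENNReal.ofReal_ne_top
  simp only [schattenNorm, if_neg hne, ENNReal.toReal_ofReal hp0.le]
  rw [aux_sum_sing A hA, aux_sum_sing (T A) hX]
  have hSA : 0 ≤ ∑ i, |hA.eigenvalues i| ^ p := Finset.sum_nonneg fun i _ => by positivity
  have hSX : 0 ≤ ∑ i, |hX.eigenvalues i| ^ p := Finset.sum_nonneg fun i _ => by positivity
  have hm : (0 : ℝ) ≤ m := Nat.cast_nonneg m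
  have e1 : (((2 * m + 1 : ℕ) : ℝ) - 1) ^ (1 - p) = 2 ^ (1 - p) * (m : ℝ) ^ (-(p - 1)) := by
    rw [← neg_sub p 1, ← Real.mul_rpow (by norm_num) hm]; push_cast; ring_nf
  have e2 : (((2 * m + 1 : ℕ) : ℝ) + 1) ^ (1 - p) = 2 ^ (1 - p) * ((m : ℝ) + 1) ^ (-(p - 1)) := by
    rw [← neg_sub p 1, ← Real.mul_rpow (by norm_num) (by linarith)]; push_cast; ring_nf
  have e3 : (2 : ℝ) ^ (2 - p) = 2 ^ (1 - p) * 2 := by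
    rw [← Real.rpow_add_one (by norm_num)]; ring_nf
  have hc : 0 < (m : ℝ) ^ (-(p - 1)) + ((m : ℝ) + 1) ^ (-(p - 1)) := by
    have := Real.rpow_nonneg hm (-(p - 1))
    have := Real.rpow_pos_of_pos (show (0 : ℝ) < m + 1 by linarith) (-(p - 1))
    linarith
  rw [e1, e2, e3, ← mul_add, mul_div_mul_left _ _ (by positivity),
    ← Real.mul_rpow (by positivity) hSA]
  refine Real.rpow_le_rpow hSX ?_ (by positivity)
  rw [div_mul_eq_mul_div, le_div_iff₀ hc]
  have := mul_le_mul_of_nonneg_right hup hc.le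
  linarith
end
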